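/- Let B₁, B₂ ∈ 𝓛(ℋ) be indefinite selfadjoint operators such that {B₁, B₂} is weakly indefinite. Then Q₁ ∩ Q₂ ≠ {0}, i.e. there exists a nonzero x ∈ ℋ with ⟨B₁x, x⟩ = ⟨B₂x, x⟩ = 0. -/

import Mathlib

open scoped InnerProductSpace

variable {H : Type*} [NormedAddCommGroup H] [InnerProductSpace ℂ H] [CompleteSpace H]

/-- The real quadratic form `x ↦ Re⟨B x, x⟩` associated to a bounded operator `B`. -/
noncomputable def qf (B : H →L[ℂ] H) (x : H) : ℝ := (⟪B x, x⟫_ℂ).re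

/-- An operator `A` is positive semidefinite if `⟨A x, x⟩ ≥ 0` for all `x`. -/
def PosSemidef (A : H →L[ℂ] H) : Prop := ∀ x : H, 0 ≤ qf A x

/-- A selfadjoint operator is indefinite if its quadratic form takes both strictly
positive and strictly negative values. -/
def Indefinite (B : H →L[ℂ] H) : Prop := (∃ x : H, 0 < qf B x) ∧ (∃ x : H, qf B x < 0)

/-- `Q(B)` : the set of neutral vectors of the quadratic form of `B`. -/
def Qset (B : H →L[ℂ] H) : Set H := {x : H | qf B x = 0}

/-- `B` is indefinite on a set `S` if its quadratic form takes both strictly positive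
and strictly negative values on `S`. -/
def IndefiniteOn (B : H →L[ℂ] H) (S : Set H) : Prop :=
  (∃ x ∈ S, 0 < qf B x) ∧ (∃ x ∈ S, qf B x < 0)

/-- A family `{B₁,…,B_m}` is weakly indefinite if every nontrivial real linear
combination `∑ μᵢ Bᵢ` is indefinite. -/
def WeaklyIndefinite {m : ℕ} (B : Fin m → (H →L[ℂ] H)) : Prop :=
  ∀ μ : Fin m → ℝ, μ ≠ 0 → Indefinite (∑ i, μ i • B i)

/-- A family `{B₁,…,B_m}` is indefinite if each `B_j` is indefinite on `⋂_{i≠j} Qᵢ`. -/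
def IndefiniteFamily {m : ℕ} (B : Fin m → (H →L[ℂ] H)) : Prop :=
  ∀ j : Fin m, IndefiniteOn (B j) {x : H | ∀ i, i ≠ j → qf (B i) x = 0}

omit [CompleteSpace H] in
theorem qf_neg (B : H →L[ℂ] H) (x : H) : qf (-B) x = -qf B x := by
  simp [qf]

omit [CompleteSpace H] in
theorem qf_smul (B : H →L[ℂ] H) (c : ℂ) (x : H) : qf B (c • x) = ‖c‖ ^ 2 * qf B x := by
  simp only [qf, map_smul, inner_smul_left, inner_smul_right]
  rw [← mul_assoc, Complex.mul_conj', ← Complex.ofReal_pow, Complex.re_ofReal_mul]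

omit [CompleteSpace H] in
theorem qf_add_real_smul (B : H →L[ℂ] H) (x y : H) (t : ℝ) :
    qf B (x + (t : ℂ) • y) =
      qf B x + t * ((⟪B x, y⟫_ℂ).re + (⟪B y, x⟫_ℂ).re) + t ^ 2 * qf B y := by
  simp only [qf, map_add, map_smul, inner_add_left, inner_add_right, inner_smul_left,
    inner_smul_right, Complex.add_re, Complex.conj_ofReal, Complex.re_ofReal_mul]
  ring

/-- Multiplying a complex number by a suitable unit makes it purely imaginary. -/
theorem exists_norm_eq_one_re_mul_eq_zero (z : ℂ) : ∃ c : ℂ, ‖c‖ = 1 ∧ (c * z).re = 0 := by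
  rcases eq_or_ne z 0 with rfl | hz
  · exact ⟨1, by simp⟩
  · have hn : (‖z‖ : ℂ) ≠ 0 := by simpa using hz
    refine ⟨Complex.I * (starRingEnd ℂ z / ‖z‖), by simp [hz], ?_⟩
    have h : Complex.I * (starRingEnd ℂ z / ‖z‖) * z = Complex.I * (‖z‖ : ℂ) := by
      have := Complex.conj_mul' z
      field_simp
      linear_combination this
    simp [h]

/-- A vector can be rotated by a phase so that it becomes `B`-orthogonal, in the real sense,
to a given vector. -/
theorem exists_phase_rotation {B : H →L[ℂ] H} (hB : IsSelfAdjoint B) (x y : H) :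
    ∃ w : H, (∀ C : H →L[ℂ] H, qf C w = qf C y) ∧
      ∀ t : ℝ, qf B (x + (t : ℂ) • w) = qf B x + t ^ 2 * qf B y := by
  obtain ⟨c, hc, hre⟩ := exists_norm_eq_one_re_mul_eq_zero ⟪B x, y⟫_ℂ
  have hq (C : H →L[ℂ] H) : qf C (c • y) = qf C y := by simp [qf_smul, hc]
  refine ⟨c • y, hq, fun t => ?_⟩
  have h₁ : (⟪B x, c • y⟫_ℂ).re = 0 := by rwa [inner_smul_right]
  have h₂ : (⟪B (c • y), x⟫_ℂ).re = 0 := by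
    have hs : ⟪B (c • y), x⟫_ℂ = ⟪c • y, B x⟫_ℂ := hB.isSymmetric (c • y) x
    rw [hs, ← inner_conj_symm, Complex.conj_re, h₁]
  rw [qf_add_real_smul, hq, h₁, h₂]
  ring

/-- A form of the S-lemma: if `B` is indefinite and no `C - r B` is negative semidefinite, then
`C` is positive at some neutral vector of `B`. -/
theorem exists_neutral_pos {B C : H →L[ℂ] H} (hB : IsSelfAdjoint B) (hi : Indefinite B)
    (h : ∀ r : ℝ, ∃ x, r * qf B x < qf C x) : ∃ x, qf B x = 0 ∧ 0 < qf C x := by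
  by_contra! hn
  have key (x y : H) (hx : 0 < qf B x) (hy : qf B y < 0) :
      qf C x / qf B x ≤ qf C y / qf B y := by
    obtain ⟨w, hw, ht⟩ := exists_phase_rotation hB x y
    set t := √(qf B x / -qf B y)
    have hb : 0 < -qf B y := neg_pos.2 hy
    have hsq : t ^ 2 = qf B x / -qf B y := Real.sq_sqrt (by positivity)
    have hz : qf B x + t ^ 2 * qf B y = 0 := by
      rw [hsq, div_neg, neg_mul, div_mul_cancel₀ _ hy.ne, add_neg_cancel]
    have hp := hn _ ((ht t).trans hz)
    have hm := hn (x + ((-t : ℝ) : ℂ) • w) (by rw [ht, neg_sq, hz])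
    rw [qf_add_real_smul, hw] at hp hm
    have hle : qf C x + qf B x / -qf B y * qf C y ≤ 0 := by
      rw [← hsq]
      linarith
    rw [div_le_iff₀ hx]
    have he : qf B x / -qf B y * qf C y = -(qf C y / qf B y * qf B x) := by
      field_simp
    linarith
  obtain ⟨⟨x₀, hx₀⟩, y₀, hy₀⟩ := hi
  let S : Set ℝ := {r | ∃ x, 0 < qf B x ∧ qf C x / qf B x = r}
  have hne : S.Nonempty := ⟨_, x₀, hx₀, rfl⟩
  have hbound (y : H) (hy : qf B y < 0) : qf C y / qf B y ∈ upperBounds S := by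
    rintro _ ⟨x, hx, rfl⟩
    exact key x y hx hy
  obtain ⟨v, hv⟩ := h (sSup S)
  rcases lt_trichotomy (qf B v) 0 with hneg | hzero | hpos
  · have := csSup_le hne (hbound v hneg)
    rw [le_div_iff_of_neg hneg] at this
    linarith
  · have := hn v hzero
    rw [hzero, mul_zero] at hv
    linarith
  · have : qf C v / qf B v ≤ sSup S := le_csSup ⟨_, hbound y₀ hy₀⟩ ⟨v, hpos, rfl⟩
    rw [div_le_iff₀ hpos] at this
    linarith

/-- If `{B₁, B₂}` is a weakly indefinite pair of indefinite selfadjoint operators,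
then `Q₁ ∩ Q₂ ≠ {0}`. -/
theorem weaklyIndefinite_pair_common_neutral (B₁ B₂ : H →L[ℂ] H)
    (h1 : IsSelfAdjoint B₁) (h2 : IsSelfAdjoint B₂)
    (hi1 : Indefinite B₁) (hi2 : Indefinite B₂)
    (hw : WeaklyIndefinite ![B₁, B₂]) :
    ∃ x : H, x ≠ 0 ∧ qf B₁ x = 0 ∧ qf B₂ x = 0 := by
  have hcomb (r : ℝ) : (∃ x, r * qf B₁ x < qf B₂ x) ∧ ∃ x, qf B₂ x < r * qf B₁ x := by
    have hq (x : H) : qf (∑ i, (![-r, 1] : Fin 2 → ℝ) i • (![B₁, B₂] : Fin 2 → H →L[ℂ] H) i) x =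
        qf B₂ x - r * qf B₁ x := by
      simp [qf, Fin.sum_univ_two, inner_smul_left_eq_smul]
      ring
    obtain ⟨⟨x, hx⟩, y, hy⟩ := hw ![-r, 1] fun h => one_ne_zero (congrFun h 1)
    rw [hq] at hx hy
    exact ⟨⟨x, by linarith⟩, y, by linarith⟩
  obtain ⟨x, hx₁, hx₂⟩ := exists_neutral_pos h1 hi1 fun r => (hcomb r).1
  obtain ⟨y, hy₁, hy₂⟩ := exists_neutral_pos (C := -B₂) h1 hi1 fun r => by
    obtain ⟨v, hv⟩ := (hcomb (-r)).2
    exact ⟨v, by rw [qf_neg]; linarith⟩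
  rw [qf_neg] at hy₂
  obtain ⟨w, hw, ht⟩ := exists_phase_rotation h1 x y
  set β := (⟪B₂ x, w⟫_ℂ).re + (⟪B₂ w, x⟫_ℂ).re
  obtain ⟨t, hroot⟩ := exists_quadratic_eq_zero (a := qf B₂ y) (b := β) (c := qf B₂ x)
    (by linarith) ⟨√(discrim (qf B₂ y) β (qf B₂ x)), by
      rw [Real.mul_self_sqrt]
      unfold discrim
      nlinarith [sq_nonneg β, mul_pos hx₂ hy₂]⟩
  refine ⟨x + (t : ℂ) • w, fun h0 => ?_, by rw [ht, hx₁, hy₁]; ring, ?_⟩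
  · have hneg : qf B₂ x = t ^ 2 * qf B₂ y := by
      rw [eq_neg_of_add_eq_zero_left h0, ← neg_smul, qf_smul, hw]
      simp
    nlinarith [sq_nonneg t]
  · rw [qf_add_real_smul, hw]
    linear_combination hroot
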